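/- Suppose R is not simply laced, let r be the ratio of the squared lengths of long and short roots, and let λ be a long root. Then D_λ(s) = (r − 1)·n(λ), where n(λ) is the total number of negative roots occurring among the members of all unordered pairs {α,β} of short roots with α + β = λ (each such pair contributing the number of its two members that are negative roots). -/

import Mathlib

open scoped RealInnerProductSpace

attribute [local instance] Classical.propDecidable

noncomputable section

/-- The reflection in the hyperplane orthogonal to `α`. -/
def sref {V : Type*} [NormedAddCommGroup V] [InnerProductSpace ℝ V] (α x : V) : V :=
  x - (2 * ⟪x, α⟫ / ⟪α, α⟫) • α

/-- The coroot `α^∨ = 2α/(α,α)`. -/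
def coroot {V : Type*} [NormedAddCommGroup V] [InnerProductSpace ℝ V] (α : V) : V :=
  (2 / ⟪α, α⟫) • α

/-- The data of a finite reduced irreducible crystallographic root system `R` in a real
inner product space, together with a fixed choice of positive roots and simple roots. -/
structure RSD (V : Type*) [NormedAddCommGroup V] [InnerProductSpace ℝ V] where
  R : Finset V
  Rpos : Finset V
  n : ℕ
  npos : 0 < n
  simple : Fin n → V
  simple_mem : ∀ i, simple i ∈ Rpos
  pos_sub : Rpos ⊆ R
  root_ne_zero : ∀ α ∈ R, α ≠ 0
  pos_or_neg : ∀ α ∈ R, α ∈ Rpos ∨ -α ∈ Rpos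
  not_both : ∀ α ∈ Rpos, -α ∉ Rpos
  pos_combo : ∀ α ∈ Rpos, ∃ c : Fin n → ℕ, α = ∑ i, (c i : ℝ) • simple i
  simple_indep : LinearIndependent ℝ simple
  reduced : ∀ α ∈ R, ∀ c : ℝ, c • α ∈ R → c = 1 ∨ c = -1
  crystal : ∀ α ∈ R, ∀ β ∈ R, ∃ k : ℤ, ⟪β, coroot α⟫ = (k : ℝ)
  refl_mem : ∀ α ∈ R, ∀ β ∈ R, sref α β ∈ R
  spanning : Submodule.span ℝ (R : Set V) = ⊤
  irred : ∀ s : Set V, (∀ α ∈ R, ∀ β ∈ R, α ∈ s → β ∉ s → ⟪α, β⟫ = 0) →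
    (∀ α ∈ R, α ∈ s) ∨ (∀ α ∈ R, α ∉ s)

namespace RSD

variable {V : Type*} [NormedAddCommGroup V] [InnerProductSpace ℝ V]

/-- The map of `V` determined by a word in the simple reflections. -/
def wordMap (S : RSD V) (l : List (Fin S.n)) : V → V :=
  l.foldr (fun i f => sref (S.simple i) ∘ f) id

/-- `w : V → V` is an element of the Weyl group `W`, i.e. a product of simple reflections. -/
def IsWeyl (S : RSD V) (w : V → V) : Prop := ∃ l : List (Fin S.n), w = S.wordMap l

/-- The length `ℓ(w)` of a Weyl group element: the smallest length of a word in the simple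
reflections representing `w`. -/
def len (S : RSD V) (w : V → V) : ℕ :=
  sInf {k | ∃ l : List (Fin S.n), l.length = k ∧ w = S.wordMap l}

/-- `x` and `y` lie in the same Weyl group orbit. -/
def sameOrbit (S : RSD V) (x y : V) : Prop := ∃ w, S.IsWeyl w ∧ w x = y

/-- `x` is dominant: `(x, α_i) ≥ 0` for all simple roots. -/
def Dominant (S : RSD V) (x : V) : Prop := ∀ i, 0 ≤ ⟪x, S.simple i⟫

/-- `w` is a Weyl group element of minimal length among those sending `x` to `y`. -/
def IsMinWord (S : RSD V) (x y : V) (w : V → V) : Prop :=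
  S.IsWeyl w ∧ w x = y ∧ ∀ w' : V → V, S.IsWeyl w' → w' x = y → S.len w ≤ S.len w'

/-- Membership in the root lattice `Q`, the ℤ-span of the simple roots. -/
def inQ (S : RSD V) (x : V) : Prop :=
  ∃ c : Fin S.n → ℤ, x = ∑ i, (c i : ℝ) • S.simple i

/-- The height `ht(λ) = Σ a_i` of an element `λ = Σ a_i α_i` of the root lattice
(the coefficients are unique since the simple roots are linearly independent). -/
def htZ (S : RSD V) (x : V) : ℤ :=
  if h : ∃ c : Fin S.n → ℤ, x = ∑ i, (c i : ℝ) • S.simple i then ∑ i, h.choose i else 0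

/-- The inversion set `Π(w) = {α ∈ R⁺ : w(α) ∈ R⁻}`. -/
def PiSet (S : RSD V) (w : V → V) : Finset V :=
  S.Rpos.filter (fun α => -(w α) ∈ S.Rpos)

/-- `α` is a short root (if all roots have the same length, all roots are short). -/
def IsShort (S : RSD V) (α : V) : Prop :=
  α ∈ S.R ∧ ∀ β ∈ S.R, ⟪α, α⟫ ≤ ⟪β, β⟫

/-- `α` is a long root. -/
def IsLong (S : RSD V) (α : V) : Prop :=
  α ∈ S.R ∧ ∀ β ∈ S.R, ⟪β, β⟫ ≤ ⟪α, α⟫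

/-- The short roots in the inversion set `Π(w)`. -/
def PiS (S : RSD V) (w : V → V) : Finset V :=
  (S.PiSet w).filter (fun α => S.IsShort α)

/-- The long roots in the inversion set `Π(w)`. -/
def PiL (S : RSD V) (w : V → V) : Finset V :=
  (S.PiSet w).filter (fun α => S.IsLong α)

end RSD


/-- The total number `n(γ)` of negative roots occurring among the members of all unordered
pairs `{α, β}` of short roots with `α + β = γ`, each pair contributing the number of its two
members that are negative roots.  Since `α ≠ β` in any such pair (as `γ` is not twice a
root), this equals the number of ordered pairs `(α, β)` of short roots with `α + β = γ`
whose first member is a negative root. -/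
def negCount {V : Type*} [NormedAddCommGroup V] [InnerProductSpace ℝ V]
    (S : RSD V) (γ : V) : ℕ :=
  ((S.R ×ˢ S.R).filter
    (fun p => S.IsShort p.1 ∧ S.IsShort p.2 ∧ p.1 + p.2 = γ ∧ -p.1 ∈ S.Rpos)).card

section Reflections

variable {V : Type*} [NormedAddCommGroup V] [InnerProductSpace ℝ V]

theorem sref_inner {α : V} (hα : α ≠ 0) (x y : V) : ⟪sref α x, sref α y⟫ = ⟪x, y⟫ := by
  have h : ⟪α, α⟫ ≠ 0 := inner_self_ne_zero.mpr hα
  simp only [sref, inner_sub_left, inner_sub_right, inner_smul_left, inner_smul_right,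
    RCLike.conj_to_real, real_inner_comm y α]
  field_simp
  ring

theorem sref_sub_smul (α x y : V) (c : ℝ) :
    sref α (x - c • y) = sref α x - c • sref α y := by
  simp only [sref, inner_sub_left, inner_smul_left, RCLike.conj_to_real]
  module

theorem sref_sref {α : V} (hα : α ≠ 0) (x : V) : sref α (sref α x) = x := by
  have h : ⟪α, α⟫ ≠ 0 := inner_self_ne_zero.mpr hα
  have hx : ⟪x - (2 * ⟪x, α⟫ / ⟪α, α⟫) • α, α⟫ = -⟪x, α⟫ := by
    rw [inner_sub_left, real_inner_smul_left]
    field_simp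
    ring
  simp only [sref, hx]
  module

theorem sref_of_inner_eq_zero {α x : V} (h : ⟪x, α⟫ = 0) : sref α x = x := by
  simp [sref, h]

end Reflections

namespace RSD

variable {V : Type*} [NormedAddCommGroup V] [InnerProductSpace ℝ V]

theorem simple_mem_R (S : RSD V) (i : Fin S.n) : S.simple i ∈ S.R :=
  S.pos_sub (S.simple_mem i)

theorem simple_ne_zero (S : RSD V) (i : Fin S.n) : S.simple i ≠ 0 :=
  S.root_ne_zero _ (S.simple_mem_R i)

@[simp]
theorem wordMap_nil (S : RSD V) (x : V) : S.wordMap [] x = x := rfl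

@[simp]
theorem wordMap_cons (S : RSD V) (i : Fin S.n) (l : List (Fin S.n)) (x : V) :
    S.wordMap (i :: l) x = sref (S.simple i) (S.wordMap l x) := rfl

theorem wordMap_inner (S : RSD V) (l : List (Fin S.n)) (x y : V) :
    ⟪S.wordMap l x, S.wordMap l y⟫ = ⟪x, y⟫ := by
  induction l with
  | nil => rfl
  | cons i l ih => rw [wordMap_cons, wordMap_cons, sref_inner (S.simple_ne_zero i), ih]

theorem wordMap_sub_smul (S : RSD V) (l : List (Fin S.n)) (x y : V) (c : ℝ) :
    S.wordMap l (x - c • y) = S.wordMap l x - c • S.wordMap l y := by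
  induction l with
  | nil => rfl
  | cons i l ih => simp only [wordMap_cons, ih, sref_sub_smul]

theorem wordMap_injective (S : RSD V) (l : List (Fin S.n)) :
    Function.Injective (S.wordMap l) := by
  induction l with
  | nil => exact Function.injective_id
  | cons i l ih =>
    exact (Function.LeftInverse.injective (sref_sref (S.simple_ne_zero i))).comp ih

theorem wordMap_mem (S : RSD V) (l : List (Fin S.n)) {x : V} (hx : x ∈ S.R) :
    S.wordMap l x ∈ S.R := by
  induction l with
  | nil => exact hx
  | cons i l ih => exact S.refl_mem _ (S.simple_mem_R i) _ ih

theorem exists_wordMap_eq (S : RSD V) (l : List (Fin S.n)) {y : V} (hy : y ∈ S.R) :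
    ∃ x ∈ S.R, S.wordMap l x = y := by
  induction l generalizing y with
  | nil => exact ⟨y, hy, rfl⟩
  | cons i l ih =>
    obtain ⟨x, hx, hxy⟩ := ih (S.refl_mem _ (S.simple_mem_R i) _ hy)
    exact ⟨x, hx, by rw [wordMap_cons, hxy, sref_sref (S.simple_ne_zero i)]⟩

theorem wordMap_sref (S : RSD V) (l : List (Fin S.n)) (α x : V) :
    S.wordMap l (sref α x) = sref (S.wordMap l α) (S.wordMap l x) := by
  simp only [sref, wordMap_sub_smul, wordMap_inner]

theorem IsShort.of_inner_self_eq {S : RSD V} {α β : V} (hα : S.IsShort α) (hβ : β ∈ S.R)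
    (h : ⟪β, β⟫ = ⟪α, α⟫) : S.IsShort β :=
  ⟨hβ, fun γ hγ => h ▸ hα.2 γ hγ⟩

theorem IsLong.of_inner_self_eq {S : RSD V} {α β : V} (hα : S.IsLong α) (hβ : β ∈ S.R)
    (h : ⟪β, β⟫ = ⟪α, α⟫) : S.IsLong β :=
  ⟨hβ, fun γ hγ => h ▸ hα.2 γ hγ⟩

theorem isShort_wordMap_iff (S : RSD V) (l : List (Fin S.n)) {α : V} (hα : α ∈ S.R) :
    S.IsShort (S.wordMap l α) ↔ S.IsShort α :=
  ⟨fun h => h.of_inner_self_eq hα (S.wordMap_inner l α α).symm,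
    fun h => h.of_inner_self_eq (S.wordMap_mem l hα) (S.wordMap_inner l α α)⟩

theorem neg_mem (S : RSD V) {α : V} (hα : α ∈ S.R) : -α ∈ S.R := by
  have h : ⟪α, α⟫ ≠ 0 := inner_self_ne_zero.mpr (S.root_ne_zero α hα)
  have := S.refl_mem α hα α hα
  rwa [sref, mul_div_assoc, div_self h, show α - ((2 : ℝ) * 1) • α = -α by module] at this

/-- A simple reflection makes only one positive root negative: the simple root itself. -/
theorem eq_simple_of_neg_sref_mem (S : RSD V) (i : Fin S.n) {β : V} (hβ : β ∈ S.Rpos)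
    (h : -(sref (S.simple i) β) ∈ S.Rpos) : β = S.simple i := by
  obtain ⟨c, hc⟩ := S.pos_combo β hβ
  obtain ⟨d, hd⟩ := S.pos_combo _ h
  set m : ℝ := 2 * ⟪β, S.simple i⟫ / ⟪S.simple i, S.simple i⟫
  have hsum : ∑ j, ((c j : ℝ) + d j - if j = i then m else 0) • S.simple j = 0 := by
    simp only [sub_smul, add_smul, Finset.sum_sub_distrib, Finset.sum_add_distrib, ← hc, ← hd,
      ite_smul, zero_smul, Finset.sum_ite_eq', Finset.mem_univ, if_true, sref]
    simp only [m]
    module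
  have hz := Fintype.linearIndependent_iff.mp S.simple_indep _ hsum
  have hc0 : ∀ j, j ≠ i → c j = 0 := by
    intro j hj
    have := hz j
    rw [if_neg hj, sub_zero] at this
    have h' : c j + d j = 0 := by exact_mod_cast this
    omega
  have hβi : β = (c i : ℝ) • S.simple i := by
    rw [hc, Finset.sum_eq_single i]
    · intro j _ hj
      simp [hc0 j hj]
    · simp
  rcases S.reduced _ (S.simple_mem_R i) (c i) (hβi ▸ S.pos_sub hβ) with h1 | h1
  · rw [hβi, h1, one_smul]
  · have : (0 : ℝ) ≤ c i := Nat.cast_nonneg _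
    linarith

/-- The strong exchange condition. -/
theorem exists_shorter_word (S : RSD V) (l : List (Fin S.n)) {α : V} (hα : α ∈ S.Rpos)
    (h : -(S.wordMap l α) ∈ S.Rpos) :
    ∃ l' : List (Fin S.n), l'.length < l.length ∧
      ∀ x, S.wordMap l' x = S.wordMap l (sref α x) := by
  induction l with
  | nil => exact absurd h (S.not_both α hα)
  | cons i l ih =>
    by_cases hneg : -(S.wordMap l α) ∈ S.Rpos
    · obtain ⟨l', hlen, hl'⟩ := ih hneg
      exact ⟨i :: l', by simpa using hlen, fun x => by simp [hl']⟩
    · have hpos := (S.pos_or_neg _ (S.wordMap_mem l (S.pos_sub hα))).resolve_right hneg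
      refine ⟨l, by simp, fun x => ?_⟩
      rw [wordMap_cons, wordMap_sref, S.eq_simple_of_neg_sref_mem i hpos h,
        sref_sref (S.simple_ne_zero i)]

theorem len_wordMap_le (S : RSD V) (l : List (Fin S.n)) : S.len (S.wordMap l) ≤ l.length :=
  Nat.sInf_le ⟨l, rfl, rfl⟩

theorem IsWeyl.exists_reduced_word {S : RSD V} {w : V → V} (hw : S.IsWeyl w) :
    ∃ l : List (Fin S.n), l.length = S.len w ∧ w = S.wordMap l := by
  obtain ⟨l, hl⟩ := hw
  exact Nat.sInf_mem (s := {k | ∃ l : List (Fin S.n), l.length = k ∧ w = S.wordMap l})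
    ⟨l.length, l, rfl, hl⟩

theorem Dominant.inner_nonneg {S : RSD V} {x α : V} (hx : S.Dominant x) (hα : α ∈ S.Rpos) :
    0 ≤ ⟪x, α⟫ := by
  obtain ⟨c, rfl⟩ := S.pos_combo α hα
  simp only [inner_sum, real_inner_smul_right]
  exact Finset.sum_nonneg fun i _ => mul_nonneg (Nat.cast_nonneg _) (hx i)

/-- Inversions of a minimal element sending a dominant `x` to `y` are not orthogonal to `x`. -/
theorem IsMinWord.inner_pos {S : RSD V} {x y α : V} {w : V → V} (hw : S.IsMinWord x y w)
    (hx : S.Dominant x) (hα : α ∈ S.PiSet w) : 0 < ⟪x, α⟫ := by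
  obtain ⟨hpos, hneg⟩ := Finset.mem_filter.mp hα
  refine (hx.inner_nonneg hpos).lt_of_ne' fun h0 => ?_
  obtain ⟨l, hlen, rfl⟩ := hw.1.exists_reduced_word
  obtain ⟨l', hlt, hl'⟩ := S.exists_shorter_word l hpos hneg
  have hmin := hw.2.2 _ ⟨l', rfl⟩ (by rw [hl', sref_of_inner_eq_zero h0, hw.2.1])
  have := S.len_wordMap_le l'
  omega

theorem IsShort.inner_self_lt {S : RSD V} (hTwo : ∃ α ∈ S.R, ∃ β ∈ S.R, ⟪α, α⟫ ≠ ⟪β, β⟫)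
    {α γ : V} (hα : S.IsShort α) (hγ : S.IsLong γ) : ⟪α, α⟫ < ⟪γ, γ⟫ := by
  obtain ⟨a, ha, b, hb, hab⟩ := hTwo
  by_contra! h
  exact hab (by linarith [hα.2 a ha, hα.2 b hb, hγ.2 a ha, hγ.2 b hb])

theorem IsLong.inner_eq_one {S : RSD V} (hTwo : ∃ α ∈ S.R, ∃ β ∈ S.R, ⟪α, α⟫ ≠ ⟪β, β⟫)
    {α γ : V} (hγ : S.IsLong γ) (hγ2 : ⟪γ, γ⟫ = 2) (hα : S.IsShort α) (hpos : 0 < ⟪γ, α⟫) :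
    ⟪γ, α⟫ = 1 := by
  obtain ⟨k, hk⟩ := S.crystal γ hγ.1 α hα.1
  rw [coroot, hγ2, div_self two_ne_zero, one_smul, real_inner_comm] at hk
  have hlt := hα.inner_self_lt hTwo hγ
  have hcs := real_inner_mul_inner_self_le γ α
  rw [hγ2] at hlt hcs
  rw [hk] at hpos hcs ⊢
  have h0 : 0 < k := by exact_mod_cast hpos
  have h2 : k * k < 4 := by
    have : (k : ℝ) * k < 4 := by linarith
    exact_mod_cast this
  have : k = 1 := by nlinarith
  simp [this]

/-- A short root `α` is a summand of a long root `γ` with short complement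
iff `(γ, α) = 1`. -/
theorem IsLong.isShort_sub_iff {S : RSD V} {α γ : V} (hγ : S.IsLong γ) (hγ2 : ⟪γ, γ⟫ = 2)
    (hα : S.IsShort α) : S.IsShort (γ - α) ↔ ⟪γ, α⟫ = 1 := by
  have hexp : ⟪γ - α, γ - α⟫ = 2 - 2 * ⟪γ, α⟫ + ⟪α, α⟫ := by
    rw [real_inner_sub_sub_self, hγ2]
  constructor
  · intro h
    linarith [h.2 α hα.1, hα.2 _ h.1]
  · intro h
    refine hα.of_inner_self_eq ?_ (by linarith)
    have := S.neg_mem (S.refl_mem γ hγ.1 α hα.1)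
    rwa [sref, hγ2, real_inner_comm, h, show -(α - ((2 : ℝ) * 1 / 2) • γ) = γ - α by module]
      at this

end RSD

theorem negCount_eq_card {V : Type*} [NormedAddCommGroup V] [InnerProductSpace ℝ V]
    (S : RSD V) {γ : V} (hγ : S.IsLong γ) (hγ2 : ⟪γ, γ⟫ = 2) :
    negCount S γ =
      (S.R.filter fun β => S.IsShort β ∧ ⟪γ, β⟫ = 1 ∧ -β ∈ S.Rpos).card := by
  refine Finset.card_nbij' Prod.fst (fun β => (β, γ - β)) ?_ ?_ ?_ ?_
  · rintro ⟨a, b⟩ h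
    simp only [Finset.coe_filter, Finset.mem_product, Set.mem_ofPred_eq] at h ⊢
    obtain ⟨⟨ha, -⟩, hsa, hsb, hab, hneg⟩ := h
    rw [← eq_sub_iff_add_eq'] at hab
    exact ⟨ha, hsa, (hγ.isShort_sub_iff hγ2 hsa).mp (hab ▸ hsb), hneg⟩
  · intro b h
    simp only [Finset.coe_filter, Finset.mem_product, Set.mem_ofPred_eq] at h ⊢
    obtain ⟨hb, hsb, h1, hneg⟩ := h
    have := (hγ.isShort_sub_iff hγ2 hsb).mpr h1
    exact ⟨⟨hb, this.1⟩, hsb, this, by abel, hneg⟩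
  · rintro ⟨a, b⟩ h
    simp only [Finset.coe_filter, Set.mem_ofPred_eq] at h
    rw [Prod.mk.injEq]
    exact ⟨rfl, (eq_sub_of_add_eq' h.2.2.2.1).symm⟩
  · intro b _
    rfl

/-- Suppose `R` is not simply laced, with squared-length ratio `r`, and `λ`
is a long root. Then `D_λ(s) = Σ_{α ∈ Π_s(w_λ)} ((λ₊, α^∨) − 1) = (r − 1)·n(λ)`. -/
theorem Ds_of_long_root
    {V : Type*} [NormedAddCommGroup V] [InnerProductSpace ℝ V]
    (S : RSD V) (hTwo : ∃ α ∈ S.R, ∃ β ∈ S.R, ⟪α, α⟫ ≠ ⟪β, β⟫)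
    (r : ℝ)
    (hr : ∀ α β : V, S.IsLong α → S.IsShort β → ⟪α, α⟫ = r * ⟪β, β⟫)
    (hnormL : ∀ α : V, S.IsLong α → ⟪α, α⟫ = 2)
    (hnormS : ∀ α : V, S.IsShort α → ⟪α, α⟫ = 2 / r)
    (lam : V) (hlong : S.IsLong lam)
    (lamp : V) (hdom : S.Dominant lamp) (horb : S.sameOrbit lam lamp)
    (w : V → V) (hw : S.IsMinWord lamp lam w) :
    ∑ α ∈ S.PiS w, (⟪lamp, coroot α⟫ - 1) = (r - 1) * (negCount S lam : ℝ) := by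
  obtain ⟨l, hl⟩ := hw.1
  obtain ⟨_, ⟨l₁, rfl⟩, hl₁⟩ := horb
  have hlamp : lamp ∈ S.R := hl₁ ▸ S.wordMap_mem l₁ hlong.1
  have hwl : S.wordMap l lamp = lam := hl ▸ hw.2.1
  have hlampL : S.IsLong lamp := hlong.of_inner_self_eq hlamp (by rw [← hwl, S.wordMap_inner])
  have hone : ∀ α ∈ S.PiS w, ⟪lamp, α⟫ = 1 := fun α hα =>
    hlampL.inner_eq_one hTwo (hnormL _ hlampL) (Finset.mem_filter.mp hα).2
      (hw.inner_pos hdom (Finset.mem_filter.mp hα).1)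
  have hterm : ∀ α ∈ S.PiS w, ⟪lamp, coroot α⟫ - 1 = r - 1 := by
    intro α hα
    have hs := (Finset.mem_filter.mp hα).2
    have hne : ⟪α, α⟫ ≠ 0 := inner_self_ne_zero.mpr (S.root_ne_zero α hs.1)
    have h2 := hr lamp α hlampL hs
    rw [hnormL _ hlampL] at h2
    rw [coroot, real_inner_smul_right, hone α hα, h2, mul_one, mul_div_assoc, div_self hne,
      mul_one]
  rw [Finset.sum_congr rfl hterm, Finset.sum_const, nsmul_eq_mul, mul_comm,
    negCount_eq_card S hlong (hnormL _ hlong)]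
  congr 2
  refine Finset.card_nbij w ?_ (hl ▸ (S.wordMap_injective l).injOn) ?_
  · intro α hα
    have h1 := hone α hα
    simp only [RSD.PiS, RSD.PiSet, Finset.coe_filter, Finset.mem_filter, Set.mem_ofPred_eq] at hα ⊢
    obtain ⟨⟨hpos, hneg⟩, hs⟩ := hα
    refine ⟨hl ▸ S.wordMap_mem l hs.1, hl ▸ (S.isShort_wordMap_iff l hs.1).mpr hs, ?_, hneg⟩
    rw [← hwl, hl, S.wordMap_inner, h1]
  · intro β hβ
    simp only [Finset.coe_filter, Set.mem_ofPred_eq] at hβ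
    obtain ⟨hβR, hs, h1, hneg⟩ := hβ
    obtain ⟨α, hα, rfl⟩ := S.exists_wordMap_eq l hβR
    rw [← hwl, S.wordMap_inner] at h1
    refine ⟨α, ?_, by rw [hl]⟩
    simp only [RSD.PiS, RSD.PiSet, Finset.coe_filter, Finset.mem_filter, Set.mem_ofPred_eq]
    refine ⟨⟨(S.pos_or_neg α hα).resolve_right fun h => ?_, hl ▸ hneg⟩,
      (S.isShort_wordMap_iff l hα).mp hs⟩
    have := hdom.inner_nonneg h
    rw [inner_neg_right, h1] at this
    linarith

end
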